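/- arXiv:2411.01944 — 2 statements merged into one kernel-verified Lean document; each statement's English description precedes it below -/
import Mathlib

section
/- Let E₁, E₂ be normed vector spaces, let x₁ : ℝ → E₁ and x₂ : ℝ → E₂, and let d₁, d₂ : ℝ → ℝ be bounded functions with d₁(t), d₂(t) ≥ 0 for all t. Let β₁, β₂ be class κℓ functions and γ₁, γ₂ be class κ functions, and suppose that for each i ∈ {1,2} and j ≠ i ∈ {1,2}, for all t₀ ≤ t, ‖xᵢ(t)‖ ≤ βᵢ(‖xᵢ(t₀)‖, t − t₀) + γᵢ(sup_{τ∈[t₀,t]} dⱼ(τ)). Suppose further there exist T ≥ 0 and constants γ̄₁, γ̄₂ ≥ 0 with γ̄₁·γ̄₂ < 1 such that for all t ≥ T, d₁(t) ≤ γ̄₁·d₂(t) and d₂(t) ≤ γ̄₂·d₁(t). Then d₁(t) = d₂(t) = 0 for all t ≥ T, and ‖x₁(t)‖ → 0 and ‖x₂(t)‖ → 0 as t → ∞. -/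
/-- A class `κ` function: continuous on `[0,∞)`, strictly increasing on `[0,∞)`,
zero at zero, and nonnegative on `[0,∞)`. -/
def IsClassK (α : ℝ → ℝ) : Prop :=
  ContinuousOn α (Set.Ici 0) ∧ StrictMonoOn α (Set.Ici 0) ∧ α 0 = 0 ∧
    ∀ r, 0 ≤ r → 0 ≤ α r

/-- A class `κℓ` function: continuous on `[0,∞) × [0,∞)`, of class `κ` in the first
argument for each fixed second argument, and non-increasing and tending to `0` at
infinity in the second argument for each fixed first argument. -/
def IsClassKL (β : ℝ → ℝ → ℝ) : Prop :=
  ContinuousOn (fun p : ℝ × ℝ => β p.1 p.2) (Set.Ici 0 ×ˢ Set.Ici 0) ∧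
  (∀ s, 0 ≤ s → IsClassK (fun r => β r s)) ∧
  (∀ r, 0 ≤ r →
    AntitoneOn (fun s => β r s) (Set.Ici 0) ∧
    Filter.Tendsto (fun s => β r s) Filter.atTop (nhds 0))

theorem cascade_aux {E : Type*} [NormedAddCommGroup E] (x : ℝ → E) (d : ℝ → ℝ)
    (β : ℝ → ℝ → ℝ) (hβ : IsClassKL β) (γ : ℝ → ℝ) (hγ : IsClassK γ) (T : ℝ)
    (hx : ∀ t₀ t, t₀ ≤ t →
      ‖x t‖ ≤ β ‖x t₀‖ (t - t₀) + γ (sSup (d '' Set.Icc t₀ t)))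
    (hd : ∀ t, T ≤ t → d t = 0) :
    Filter.Tendsto (fun t => ‖x t‖) Filter.atTop (nhds 0) := by
  have hlim := ((hβ.2.2 ‖x T‖ (norm_nonneg _)).2).comp
    (Filter.tendsto_atTop_add_const_right Filter.atTop (-T) Filter.tendsto_id)
  refine tendsto_of_tendsto_of_tendsto_of_le_of_le' tendsto_const_nhds hlim
    (Filter.Eventually.of_forall fun t => norm_nonneg _) ?_
  filter_upwards [Filter.eventually_ge_atTop T] with t ht
  have h := hx T t ht
  have himg : d '' Set.Icc T t = {0} := by
    ext y
    constructor
    · rintro ⟨s, hs, rfl⟩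
      exact hd s hs.1
    · rintro rfl
      exact ⟨T, ⟨le_refl _, ht⟩, hd T le_rfl⟩
  rw [himg, csSup_singleton, hγ.2.2.1, add_zero] at h
  simpa [sub_eq_add_neg] using h

/-- **Abstract small-gain theorem for the cascaded closed loop (Theorem 1).**
ISS estimates for the two subsystems, the asymptotic gain inequalities, and the
small-gain condition `γ̄₁ * γ̄₂ < 1` imply that the exogenous inputs vanish for
`t ≥ T` and that both state errors converge to zero. -/
theorem smallGain_cascade_convergence
    {E₁ E₂ : Type*} [NormedAddCommGroup E₁] [NormedAddCommGroup E₂]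
    (x₁ : ℝ → E₁) (x₂ : ℝ → E₂) (d₁ d₂ : ℝ → ℝ)
    (hd₁0 : ∀ t, 0 ≤ d₁ t) (hd₂0 : ∀ t, 0 ≤ d₂ t)
    (hd₁b : BddAbove (Set.range d₁)) (hd₂b : BddAbove (Set.range d₂))
    (β₁ β₂ : ℝ → ℝ → ℝ) (hβ₁ : IsClassKL β₁) (hβ₂ : IsClassKL β₂)
    (γ₁ γ₂ : ℝ → ℝ) (hγ₁ : IsClassK γ₁) (hγ₂ : IsClassK γ₂)
    (hx₁ : ∀ t₀ t, t₀ ≤ t →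
      ‖x₁ t‖ ≤ β₁ ‖x₁ t₀‖ (t - t₀) + γ₁ (sSup (d₂ '' Set.Icc t₀ t)))
    (hx₂ : ∀ t₀ t, t₀ ≤ t →
      ‖x₂ t‖ ≤ β₂ ‖x₂ t₀‖ (t - t₀) + γ₂ (sSup (d₁ '' Set.Icc t₀ t)))
    (T γbar₁ γbar₂ : ℝ) (hT : 0 ≤ T) (hγb₁ : 0 ≤ γbar₁) (hγb₂ : 0 ≤ γbar₂)
    (hsg : γbar₁ * γbar₂ < 1)
    (h1 : ∀ t, T ≤ t → d₁ t ≤ γbar₁ * d₂ t)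
    (h2 : ∀ t, T ≤ t → d₂ t ≤ γbar₂ * d₁ t) :
    (∀ t, T ≤ t → d₁ t = 0 ∧ d₂ t = 0) ∧
    Filter.Tendsto (fun t => ‖x₁ t‖) Filter.atTop (nhds 0) ∧
    Filter.Tendsto (fun t => ‖x₂ t‖) Filter.atTop (nhds 0) := by
  have hz : ∀ t, T ≤ t → d₁ t = 0 ∧ d₂ t = 0 := by
    intro t ht
    have a := h1 t ht
    have b := h2 t ht
    have c := mul_le_mul_of_nonneg_left b hγb₁
    have e : d₁ t = 0 := by
      have := hd₁0 t
      nlinarith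
    refine ⟨e, ?_⟩
    rw [e, mul_zero] at b
    exact le_antisymm b (hd₂0 t)
  exact ⟨hz, cascade_aux x₁ d₂ β₁ hβ₁ γ₁ hγ₁ T hx₁ fun t ht => (hz t ht).2,
    cascade_aux x₂ d₁ β₂ hβ₂ γ₂ hγ₂ T hx₂ fun t ht => (hz t ht).1⟩
end

section
/- Let Ĩ, ℓ, m̃, g, Iᵤ > 0. Let A be the 4×4 real matrix with rows (0,1,0,0), (ℓm̃g/Ĩ, 0, 0, 0), (0,0,0,1), (0,0,0,0) and B the 4×2 real matrix with rows (0,0), (0,0), (0,0), (0, 1/Iᵤ). Then the 4×8 controllability matrix C = [B AB A²B A³B], formed by concatenating the columns of B, AB, A²B, A³B, has rank exactly 2; in particular rank(C) ≠ 4, so the Kalman rank condition for controllability fails. -/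
/-- **Failure of the Kalman rank condition (Assumption 3).**
For the planar UAV–object system linearized around the minimum-energy equilibrium,
the controllability matrix `C = [B  AB  A²B  A³B]` (columns indexed by
`(k, j) : Fin 4 × Fin 2`, the `j`-th column of `AᵏB`) has rank exactly `2`;
in particular its rank is not `4`. Here `Itil = Ĩ`, `mtil = m̃`. -/
theorem uav_planar_kalman_rank_fails
    (Itil ℓ mtil g Iu : ℝ) (hItil : 0 < Itil) (hℓ : 0 < ℓ) (hmtil : 0 < mtil)
    (hg : 0 < g) (hIu : 0 < Iu) :
    let A : Matrix (Fin 4) (Fin 4) ℝ :=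
      !![0, 1, 0, 0;
         ℓ * mtil * g / Itil, 0, 0, 0;
         0, 0, 0, 1;
         0, 0, 0, 0]
    let B : Matrix (Fin 4) (Fin 2) ℝ :=
      !![0, 0; 0, 0; 0, 0; 0, 1 / Iu]
    let C : Matrix (Fin 4) (Fin 4 × Fin 2) ℝ :=
      fun i k => (A ^ (k.1 : ℕ) * B) i k.2
    C.rank = 2 ∧ C.rank ≠ 4 := by
  intro A B C
  have h0 : A ^ 0 * B = B := by simp
  have h1 : A ^ 1 * B = !![0, 0; 0, 0; 0, 1 / Iu; 0, 0] := by
    rw [pow_one]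
    ext i j
    fin_cases i <;> fin_cases j <;> simp [A, B, Matrix.mul_apply, Fin.sum_univ_four]
  have h2 : A ^ 2 * B = 0 := by
    rw [pow_succ', Matrix.mul_assoc, h1]
    ext i j
    fin_cases i <;> fin_cases j <;> simp [A, Matrix.mul_apply, Fin.sum_univ_four]
  have h3 : A ^ 3 * B = 0 := by
    rw [pow_succ', Matrix.mul_assoc, h2, Matrix.mul_zero]
  have hC : ∀ i (k : Fin 4) (j : Fin 2), C i (k, j) = (A ^ (k : ℕ) * B) i j := fun _ _ _ => rfl
  have c0 : ∀ i j, C i (0, j) = B i j := fun i j => by rw [hC]; exact congrFun (congrFun h0 i) j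
  have c1 : ∀ i j, C i (1, j) = (!![0, 0; 0, 0; 0, 1 / Iu; 0, 0] : Matrix (Fin 4) (Fin 2) ℝ) i j :=
    fun i j => by rw [hC]; exact congrFun (congrFun h1 i) j
  have c2 : ∀ i j, C i (2, j) = 0 := fun i j => by rw [hC]; exact congrFun (congrFun h2 i) j
  have c3 : ∀ i j, C i (3, j) = 0 := fun i j => by rw [hC]; exact congrFun (congrFun h3 i) j
  clear_value C
  have hne : Iu ≠ 0 := hIu.ne'
  let P : Matrix (Fin 4) (Fin 2) ℝ := !![0, 0; 0, 0; 1, 0; 0, 1]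
  let L : Matrix (Fin 2) (Fin 4) ℝ := !![0, 0, 1, 0; 0, 0, 0, 1]
  let R : Matrix (Fin 4 × Fin 2) (Fin 2) ℝ := fun k c =>
    if k = (1, 1) ∧ c = 0 then Iu else if k = (0, 1) ∧ c = 1 then Iu else 0
  have e1 : C = P * (L * C) := by
    ext i ⟨k, j⟩
    fin_cases k <;> fin_cases i <;> fin_cases j <;>
      simp [P, L, B, Matrix.vecMul, dotProduct, Matrix.mul_apply, Fin.sum_univ_four, c0, c1, c2, c3]
  have e2 : L * C * R = 1 := by
    ext i j
    rw [Matrix.mul_apply, Fintype.sum_prod_type]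
    simp only [Matrix.mul_apply, Fin.sum_univ_four, Fin.sum_univ_two, c0, c1, c2, c3]
    fin_cases i <;> fin_cases j <;>
      simp [L, R, B, Matrix.vecMul, dotProduct, Matrix.mul_apply, Fin.sum_univ_four, Fintype.sum_prod_type, c0, c1, c2, c3, hne]
  have u : C.rank ≤ 2 := by
    rw [e1]
    exact (Matrix.rank_mul_le_left _ _).trans (by simpa using P.rank_le_width)
  have l : 2 ≤ C.rank := by
    have h : (L * C * R).rank = 2 := by rw [e2]; simp [Matrix.rank_one]
    exact h.symm.le.trans ((Matrix.rank_mul_le_left _ _).trans (Matrix.rank_mul_le_right _ _))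
  omega
end
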